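/- arXiv:2402.04496 — 2 statements merged into one kernel-verified Lean document; each statement's English description precedes it below -/
import Mathlib

section
/- Let E be a Banach space and 1 < p < ∞. If (x_j)_{j=1}^∞ is a Cohen strongly p-summable sequence in E, then (x_j)_{j=1}^∞ is mid p-summable and ‖(x_j)‖_{mid,p} ≤ ‖(x_j)‖_{C,p}. -/
open Filter Topology
open scoped ENNReal NNReal

/-- The weak `ℓ_p` "norm" of a Banach-space valued sequence, valued in `ℝ≥0∞`:
`sup_{‖φ‖ ≤ 1} (∑_j |φ(x_j)|^p)^{1/p}`. -/
noncomputable def weakLpNorm (𝕜 : Type*) [RCLike 𝕜] {X : Type*} [NormedAddCommGroup X]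
    [NormedSpace 𝕜 X] (p : ℝ) (x : ℕ → X) : ℝ≥0∞ :=
  ⨆ φ ∈ {φ : X →L[𝕜] 𝕜 | ‖φ‖ ≤ 1}, (∑' j, (‖φ (x j)‖₊ : ℝ≥0∞) ^ p) ^ (1 / p)

/-- A sequence is weakly `p`-summable if `(φ(x_j))_j ∈ ℓ_p` for every continuous functional. -/
def WeaklyLpSummable (𝕜 : Type*) [RCLike 𝕜] {X : Type*} [NormedAddCommGroup X]
    [NormedSpace 𝕜 X] (p : ℝ) (x : ℕ → X) : Prop :=
  ∀ φ : X →L[𝕜] 𝕜, Summable fun j => ‖φ (x j)‖ ^ p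

/-- The mid `p`-"norm" of a sequence, valued in `ℝ≥0∞`: the supremum of
`(∑_n ∑_j |φ_n(x_j)|^p)^{1/p}` over all weakly `p`-summable sequences `(φ_n)` in the dual
with weak `p`-norm at most one.  A sequence is mid `p`-summable iff this is `< ⊤`. -/
noncomputable def midLpNorm (𝕜 : Type*) [RCLike 𝕜] {X : Type*} [NormedAddCommGroup X]
    [NormedSpace 𝕜 X] (p : ℝ) (x : ℕ → X) : ℝ≥0∞ :=
  ⨆ φ ∈ {φ : ℕ → X →L[𝕜] 𝕜 | WeaklyLpSummable 𝕜 p φ ∧ weakLpNorm 𝕜 p φ ≤ 1},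
    (∑' n, ∑' j, (‖φ n (x j)‖₊ : ℝ≥0∞) ^ p) ^ (1 / p)

/-- The Cohen strong `p`-"norm" of a sequence, valued in `ℝ≥0∞`: the supremum of
`∑_j |φ_j(x_j)|` over all weakly `p*`-summable sequences `(φ_j)` in the dual with weak
`p*`-norm at most one, where `p* = p/(p-1)`.  A sequence is Cohen strongly `p`-summable
iff this is `< ⊤`. -/
noncomputable def cohenLpNorm (𝕜 : Type*) [RCLike 𝕜] {X : Type*} [NormedAddCommGroup X]
    [NormedSpace 𝕜 X] (p : ℝ) (x : ℕ → X) : ℝ≥0∞ :=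
  ⨆ φ ∈ {φ : ℕ → X →L[𝕜] 𝕜 | WeaklyLpSummable 𝕜 (p / (p - 1)) φ ∧
      weakLpNorm 𝕜 (p / (p - 1)) φ ≤ 1},
    ∑' j, (‖φ j (x j)‖₊ : ℝ≥0∞)

theorem aux_hoelder {𝕜 : Type*} [RCLike 𝕜] {p q : ℝ} (hpq : p.HolderConjugate q)
    (A : Finset ℕ) (w u : ℕ → 𝕜) (hu : ∑ n ∈ A, ‖u n‖ ^ p ≤ 1) :
    ‖∑ n ∈ A, w n * u n‖ ^ q ≤ ∑ n ∈ A, ‖w n‖ ^ q := by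
  have hq := hpq.symm.pos
  have h1 : ‖∑ n ∈ A, w n * u n‖ ≤ (∑ n ∈ A, ‖w n‖ ^ q) ^ (1 / q) := by
    calc ‖∑ n ∈ A, w n * u n‖ ≤ ∑ n ∈ A, ‖w n‖ * ‖u n‖ := by
          refine (norm_sum_le _ _).trans (le_of_eq ?_)
          simp
      _ ≤ (∑ n ∈ A, ‖w n‖ ^ q) ^ (1 / q) * (∑ n ∈ A, ‖u n‖ ^ p) ^ (1 / p) := by
          have := Real.inner_le_Lp_mul_Lq A (fun n => ‖w n‖) (fun n => ‖u n‖) hpq.symm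
          simpa using this
      _ ≤ (∑ n ∈ A, ‖w n‖ ^ q) ^ (1 / q) * 1 := by
          gcongr
          exact Real.rpow_le_one (by positivity) hu (by have := hpq.pos; positivity)
      _ = _ := mul_one _
  calc ‖∑ n ∈ A, w n * u n‖ ^ q ≤ ((∑ n ∈ A, ‖w n‖ ^ q) ^ (1 / q)) ^ q := by gcongr
    _ = _ := by
      rw [← Real.rpow_mul (by positivity), one_div, inv_mul_cancel₀ hq.ne', Real.rpow_one]

theorem aux_weight {𝕜 : Type*} [RCLike 𝕜] {p : ℝ} (hp : 1 < p) (a : 𝕜) :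
    ∃ w : 𝕜, w * a = ((‖a‖ ^ p : ℝ) : 𝕜) ∧ ‖w‖ ^ (p / (p - 1)) = ‖a‖ ^ p := by
  have hp1 : 0 < p - 1 := by linarith
  by_cases ha : a = 0
  · refine ⟨0, ?_, ?_⟩
    · simp [ha, Real.zero_rpow (by linarith : p ≠ 0)]
    · simp [ha, Real.zero_rpow (by linarith : p ≠ 0),
        Real.zero_rpow (by positivity : p / (p - 1) ≠ 0)]
  · have hn : 0 < ‖a‖ := norm_pos_iff.mpr ha
    refine ⟨((‖a‖ ^ (p - 2) : ℝ) : 𝕜) * (starRingEnd 𝕜) a, ?_, ?_⟩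
    · rw [mul_assoc, RCLike.conj_mul, ← RCLike.ofReal_pow, ← RCLike.ofReal_mul,
        ← Real.rpow_natCast, ← Real.rpow_add hn]
      norm_num
    · rw [norm_mul, RCLike.norm_conj, RCLike.norm_ofReal, abs_of_nonneg (by positivity)]
      nth_rewrite 2 [← Real.rpow_one ‖a‖]
      rw [← Real.rpow_add hn, ← Real.rpow_mul hn.le]
      congr 1
      field_simp
      ring

theorem aux_coe {F : Type*} [SeminormedAddCommGroup F] (y : F) {p : ℝ} (hp : 0 ≤ p) :
    (‖y‖₊ : ℝ≥0∞) ^ p = ENNReal.ofReal (‖y‖ ^ p) := by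
  rw [← ENNReal.ofReal_rpow_of_nonneg (norm_nonneg _) hp, ofReal_norm]
  rfl

theorem aux_fin {𝕜 : Type*} [RCLike 𝕜] {E : Type*} [NormedAddCommGroup E] [NormedSpace 𝕜 E]
    {p : ℝ} (hp : 1 < p) (x : ℕ → E) (φ : ℕ → E →L[𝕜] 𝕜) (hφ : weakLpNorm 𝕜 p φ ≤ 1)
    (A B : Finset ℕ) :
    ENNReal.ofReal ((∑ j ∈ B, ∑ n ∈ A, ‖φ n (x j)‖ ^ p) ^ (1 / p)) ≤ cohenLpNorm 𝕜 p x := by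
  have hpq : p.HolderConjugate (p / (p - 1)) := Real.HolderConjugate.conjExponent hp
  have hp0 := hpq.pos
  set q := p / (p - 1) with hqdef
  have hq0 : 0 < q := hpq.symm.pos
  set S := ∑ j ∈ B, ∑ n ∈ A, ‖φ n (x j)‖ ^ p with hS
  have hS0 : 0 ≤ S := by positivity
  rcases hS0.eq_or_lt with h0 | hpos
  · rw [← h0, Real.zero_rpow (by positivity)]
    simp
  choose w hw1 hw2 using fun n j => aux_weight hp (φ n (x j))
  simp only [← hqdef] at hw2
  set s : ℝ := S ^ (-(1 / q)) with hs
  have hs0 : 0 < s := by positivity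
  have hsq : s ^ q = S⁻¹ := by
    rw [hs, ← Real.rpow_mul hS0, neg_mul, one_div, inv_mul_cancel₀ hq0.ne', Real.rpow_neg_one]
  have hsS : s * S = S ^ (1 / p) := by
    rw [hs, ← Real.rpow_add_one hpos.ne']
    congr 1
    have := hpq.inv_add_inv_eq_one
    rw [one_div, one_div]
    linarith
  let ψ : ℕ → E →L[𝕜] 𝕜 := fun j => if j ∈ B then (s : 𝕜) • ∑ n ∈ A, w n j • φ n else 0
  have hψ0 : ∀ j, j ∉ B → ψ j = 0 := fun j hj => if_neg hj
  have hψ1 : ∀ j, j ∈ B → ψ j = (s : 𝕜) • ∑ n ∈ A, w n j • φ n := fun j hj => if_pos hj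
  have hsum : ∀ Φ : (E →L[𝕜] 𝕜) →L[𝕜] 𝕜, ‖Φ‖ ≤ 1 → ∑ j ∈ B, ‖Φ (ψ j)‖ ^ q ≤ 1 := by
    intro Φ hΦ
    have hu : ∑ n ∈ A, ‖Φ (φ n)‖ ^ p ≤ 1 := by
      have h1 : (∑' j, (‖Φ (φ j)‖₊ : ℝ≥0∞) ^ p) ^ (1 / p) ≤ 1 :=
        (le_iSup₂_of_le (f := fun (Φ : (E →L[𝕜] 𝕜) →L[𝕜] 𝕜) (_ : Φ ∈ {Φ : (E →L[𝕜] 𝕜) →L[𝕜] 𝕜 | ‖Φ‖ ≤ 1}) =>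
          (∑' j, (‖Φ (φ j)‖₊ : ℝ≥0∞) ^ p) ^ (1 / p)) Φ hΦ le_rfl).trans hφ
      have h2 : (∑' j, (‖Φ (φ j)‖₊ : ℝ≥0∞) ^ p) ≤ 1 := by
        rw [one_div, ENNReal.rpow_inv_le_iff hp0] at h1
        simpa using h1
      have h3 := (ENNReal.sum_le_tsum A).trans h2
      simp_rw [aux_coe _ hp0.le] at h3
      rw [← ENNReal.ofReal_sum_of_nonneg (fun _ _ => by positivity)] at h3
      simpa using h3
    calc ∑ j ∈ B, ‖Φ (ψ j)‖ ^ q ≤ ∑ j ∈ B, S⁻¹ * ∑ n ∈ A, ‖φ n (x j)‖ ^ p := by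
          refine Finset.sum_le_sum fun j hj => ?_
          have h4 := aux_hoelder hpq A (fun n => w n j) (fun n => Φ (φ n)) hu
          simp only [hw2] at h4
          rw [hψ1 j hj, map_smul, map_sum, norm_smul, RCLike.norm_ofReal, abs_of_pos hs0,
            Real.mul_rpow hs0.le (norm_nonneg _), hsq]
          simp only [map_smul, smul_eq_mul]
          gcongr
      _ = 1 := by
          rw [← Finset.mul_sum, ← hS, inv_mul_cancel₀ hpos.ne']
  have hmem : ψ ∈ {φ : ℕ → E →L[𝕜] 𝕜 | WeaklyLpSummable 𝕜 (p / (p - 1)) φ ∧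
      weakLpNorm 𝕜 (p / (p - 1)) φ ≤ 1} := by
    refine ⟨fun Φ => ?_, ?_⟩
    · refine summable_of_ne_finset_zero (s := B) fun j hj => ?_
      rw [hψ0 j hj]
      simp [Real.zero_rpow hq0.ne', ← hqdef]
    · refine iSup₂_le fun Φ hΦ => ?_
      rw [← hqdef, tsum_eq_sum (s := B) (fun j hj => by rw [hψ0 j hj]; simp [hq0])]
      simp_rw [aux_coe _ hq0.le]
      rw [← ENNReal.ofReal_sum_of_nonneg (fun _ _ => by positivity)]
      refine ENNReal.rpow_le_one ?_ (by positivity)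
      simpa using hsum Φ hΦ
  refine le_trans ?_ (le_iSup₂_of_le (f := fun (ψ : ℕ → E →L[𝕜] 𝕜) (_ : ψ ∈ {φ : ℕ → E →L[𝕜] 𝕜 | WeaklyLpSummable 𝕜 (p / (p - 1)) φ ∧
      weakLpNorm 𝕜 (p / (p - 1)) φ ≤ 1}) => ∑' j, (‖ψ j (x j)‖₊ : ℝ≥0∞)) ψ hmem le_rfl)
  refine le_trans (le_of_eq ?_) (ENNReal.sum_le_tsum B)
  have h5 : ∀ j ∈ B, (‖ψ j (x j)‖₊ : ℝ≥0∞) = ENNReal.ofReal (s * ∑ n ∈ A, ‖φ n (x j)‖ ^ p) := by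
    intro j hj
    have h6 : ψ j (x j) = ((s * ∑ n ∈ A, ‖φ n (x j)‖ ^ p : ℝ) : 𝕜) := by
      rw [hψ1 j hj]
      simp only [ContinuousLinearMap.smul_apply, ContinuousLinearMap.sum_apply, smul_eq_mul, hw1]
      push_cast
      rfl
    have h7 := aux_coe (ψ j (x j)) zero_le_one
    rw [ENNReal.rpow_one, Real.rpow_one] at h7
    rw [h7, h6, RCLike.norm_ofReal, abs_of_nonneg (by positivity)]
  rw [Finset.sum_congr rfl h5, ← ENNReal.ofReal_sum_of_nonneg (fun _ _ => by positivity),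
    ← Finset.mul_sum, ← hS, hsS]

/-- For `1 < p < ∞`, every Cohen strongly `p`-summable sequence in a
Banach space `E` is mid `p`-summable, with `‖(x_j)‖_{mid,p} ≤ ‖(x_j)‖_{C,p}`. -/
theorem stmt_14 {𝕜 : Type*} [RCLike 𝕜] {E : Type*} [NormedAddCommGroup E] [NormedSpace 𝕜 E]
    [CompleteSpace E] {p : ℝ} (hp : 1 < p) (x : ℕ → E) (hx : cohenLpNorm 𝕜 p x < ⊤) :
    midLpNorm 𝕜 p x < ⊤ ∧ midLpNorm 𝕜 p x ≤ cohenLpNorm 𝕜 p x := by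
  have key : midLpNorm 𝕜 p x ≤ cohenLpNorm 𝕜 p x := by
    have hp0 : 0 < p := by linarith
    refine iSup₂_le fun φ hφ => ?_
    rw [one_div, ENNReal.rpow_inv_le_iff hp0, ← ENNReal.tsum_prod, ENNReal.tsum_eq_iSup_sum]
    refine iSup_le fun s => ?_
    rw [← ENNReal.rpow_inv_le_iff hp0, ← one_div]
    refine le_trans ?_ (aux_fin hp x φ hφ.2 (s.image Prod.fst) (s.image Prod.snd))
    rw [← ENNReal.ofReal_rpow_of_nonneg (by positivity) (by positivity)]
    refine ENNReal.rpow_le_rpow ?_ (by positivity)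
    simp_rw [aux_coe _ hp0.le]
    rw [← ENNReal.ofReal_sum_of_nonneg (fun _ _ => by positivity)]
    refine ENNReal.ofReal_le_ofReal ?_
    rw [Finset.sum_comm, ← Finset.sum_product']
    exact Finset.sum_le_sum_of_subset_of_nonneg Finset.subset_product (fun _ _ _ => by positivity)
  exact ⟨key.trans_lt hx, key⟩
end

section
/- Let E be a Banach space, 1 < p < ∞ and p* = p/(p−1). A bounded linear operator u : ℓ_{p*} → E is compact if and only if for every weakly p-summable sequence (y_j)_{j=1}^∞ in ℓ_{p*} the sequence (u(y_j))_{j=1}^∞ is unconditionally p-summable in E. -/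
open Filter Topology
open scoped ENNReal NNReal

/-- A sequence is unconditionally `p`-summable if it is weakly `p`-summable and the weak
`p`-norms of its tails tend to zero. -/
def UncondLpSummable (𝕜 : Type*) [RCLike 𝕜] {X : Type*} [NormedAddCommGroup X]
    [NormedSpace 𝕜 X] (p : ℝ) (x : ℕ → X) : Prop :=
  WeaklyLpSummable 𝕜 p x ∧
    Tendsto (fun n : ℕ => weakLpNorm 𝕜 p fun j => x (n + j)) atTop (𝓝 (0 : ℝ≥0∞))

lemma aux_dual {𝕜 : Type*} [RCLike 𝕜] {p q : ℝ} (hpq : p.HolderConjugate q) (s : Finset ℕ)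
    (b : ℕ → 𝕜) : ∃ a : ℕ → 𝕜, ∑ j ∈ s, ‖a j‖ ^ q ≤ 1 ∧
      ∑ j ∈ s, a j * b j = (((∑ j ∈ s, ‖b j‖ ^ p) ^ (1 / p) : ℝ) : 𝕜) := by
  obtain ⟨g, hg, hgs⟩ := (NNReal.isGreatest_Lp s (fun j => ‖b j‖₊) hpq).1
  choose c hc hcb using fun j => RCLike.exists_norm_eq_mul_self (b j)
  refine ⟨fun j => ((g j : ℝ) : 𝕜) * c j, ?_, ?_⟩
  · have : ∑ j ∈ s, (g j : ℝ) ^ q ≤ 1 := by exact_mod_cast hg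
    simpa [hc] using this
  · have h2 : ∑ j ∈ s, ‖b j‖ * (g j : ℝ) = (∑ j ∈ s, ‖b j‖ ^ p) ^ (1 / p) := by
      have := congrArg (fun t : ℝ≥0 => (t : ℝ)) hgs
      simpa using this
    rw [← h2]
    push_cast
    refine Finset.sum_congr rfl fun j _ => ?_
    rw [mul_assoc, ← hcb, mul_comm]

lemma aux_holder {𝕜 : Type*} [RCLike 𝕜] {p q : ℝ} (hpq : p.HolderConjugate q) (s : Finset ℕ)
    (a b : ℕ → 𝕜) : ‖∑ j ∈ s, a j * b j‖ ≤
      (∑ j ∈ s, ‖a j‖ ^ q) ^ (1 / q) * (∑ j ∈ s, ‖b j‖ ^ p) ^ (1 / p) := by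
  refine (norm_sum_le _ _).trans ?_
  simp only [norm_mul]
  exact Real.inner_le_Lp_mul_Lq_of_nonneg s hpq.symm (fun _ _ => norm_nonneg _)
    (fun _ _ => norm_nonneg _)

lemma aux_rpow {p c t : ℝ} (hp : 0 < p) (hc : 0 ≤ c) (ht : 0 ≤ t) :
    t ^ (1 / p) ≤ c ↔ t ≤ c ^ p := by
  rw [one_div]
  exact Real.rpow_inv_le_iff_of_pos ht hc hp

lemma weakLpNorm_le_iff {𝕜 : Type*} [RCLike 𝕜] {X : Type*} [NormedAddCommGroup X]
    [NormedSpace 𝕜 X] {p : ℝ} (hp : 0 < p) (x : ℕ → X) {c : ℝ} (hc : 0 ≤ c) :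
    weakLpNorm 𝕜 p x ≤ ENNReal.ofReal c ↔ ∀ φ : X →L[𝕜] 𝕜, ‖φ‖ ≤ 1 → ∀ s : Finset ℕ,
      (∑ j ∈ s, ‖φ (x j)‖ ^ p) ^ (1 / p) ≤ c := by
  unfold weakLpNorm
  rw [iSup₂_le_iff]
  refine forall_congr' fun φ => forall_congr' fun _ => ?_
  rw [one_div, ENNReal.rpow_inv_le_iff hp, ENNReal.tsum_eq_iSup_sum, iSup_le_iff]
  refine forall_congr' fun s => ?_
  rw [Real.rpow_inv_le_iff_of_pos (Finset.sum_nonneg fun _ _ => by positivity) hc hp,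
    ENNReal.ofReal_rpow_of_nonneg hc hp.le,
    ← ENNReal.ofReal_le_ofReal_iff (by positivity),
    ENNReal.ofReal_sum_of_nonneg (fun _ _ => by positivity)]
  have : ∀ j, ENNReal.ofReal (‖φ (x j)‖ ^ p) = (‖φ (x j)‖₊ : ℝ≥0∞) ^ p := fun j => by
    rw [← ENNReal.ofReal_rpow_of_nonneg (norm_nonneg _) hp.le, ofReal_norm]; rfl
  simp only [this]

lemma aux_bdd {𝕜 : Type*} [RCLike 𝕜] {X : Type*} [NormedAddCommGroup X]
    [NormedSpace 𝕜 X] (x : ℕ → X)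
    (h : ∀ ψ : X →L[𝕜] 𝕜, Tendsto (fun n => ψ (x n)) atTop (𝓝 0)) : ∃ C, ∀ n, ‖x n‖ ≤ C := by
  obtain ⟨C, hC⟩ := banach_steinhaus (𝕜 := 𝕜) (𝕜₂ := 𝕜) (σ₁₂ := RingHom.id 𝕜)
    (g := fun n => NormedSpace.inclusionInDoubleDualLi (E := X) 𝕜 (x n)) (by
      intro ψ
      obtain ⟨C, hC⟩ := (h ψ).norm.bddAbove_range
      exact ⟨C, fun i => hC ⟨i, rfl⟩⟩)
  exact ⟨C, fun n =>
    ((NormedSpace.inclusionInDoubleDualLi (E := X) 𝕜).norm_map (x n)).symm.le.trans (hC n)⟩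

lemma aux_compact {𝕜 : Type*} [RCLike 𝕜] {X E : Type*} [NormedAddCommGroup X]
    [NormedSpace 𝕜 X] [NormedAddCommGroup E] [NormedSpace 𝕜 E] (u : X →L[𝕜] E)
    (hu : IsCompactOperator u) (x : ℕ → X)
    (h : ∀ ψ : X →L[𝕜] 𝕜, Tendsto (fun n => ψ (x n)) atTop (𝓝 0))
    {c : ℝ} (hc : 0 < c) (hx : ∀ n, c ≤ ‖u (x n)‖) : False := by
  obtain ⟨C, hC⟩ := aux_bdd x h
  obtain ⟨K, hK, hKs⟩ := IsCompactOperator.image_closedBall_subset_compact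
    (f := (u : X →ₗ[𝕜] E)) hu C
  obtain ⟨z, -, φ, hφ, hz⟩ := hK.tendsto_subseq (x := fun n => u (x n))
    (fun n => hKs ⟨x n, by simpa using hC n, rfl⟩)
  have hz0 : z = 0 := by
    refine SeparatingDual.eq_zero_of_forall_dual_eq_zero (R := 𝕜) fun ψ => ?_
    have h1 := (ψ.continuous.tendsto z).comp hz
    have h2 := (h (ψ.comp u)).comp hφ.tendsto_atTop
    exact tendsto_nhds_unique h1 h2
  have := ge_of_tendsto' hz.norm (fun n => hx (φ n))
  simp [hz0] at this
  linarith

lemma aux_forward {𝕜 : Type*} [RCLike 𝕜] {X E : Type*} [NormedAddCommGroup X]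
    [NormedSpace 𝕜 X] [NormedAddCommGroup E] [NormedSpace 𝕜 E] {p q : ℝ}
    (hpq : p.HolderConjugate q) (u : X →L[𝕜] E)
    (hu : IsCompactOperator u) (y : ℕ → X) (hy : WeaklyLpSummable 𝕜 p y) :
    UncondLpSummable 𝕜 p fun j => u (y j) := by
  have hp := hpq.pos
  refine ⟨fun φ => hy (φ.comp u), ?_⟩
  rw [ENNReal.tendsto_atTop_zero]
  intro ε hε
  obtain ⟨c, hc0, hcε⟩ : ∃ c : ℝ, 0 < c ∧ ENNReal.ofReal c ≤ ε := by
    obtain ⟨r, hr0, hr⟩ := ENNReal.lt_iff_exists_nnreal_btwn.1 hε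
    exact ⟨r, by exact_mod_cast hr0, by simpa using hr.le⟩
  by_contra! hcon
  have key : ∀ N : ℕ, ∃ x : X, c ≤ ‖u x‖ ∧ ∃ n ≥ N, ∀ ψ : X →L[𝕜] 𝕜,
      ‖ψ x‖ ≤ (∑' j, ‖ψ (y (j + n))‖ ^ p) ^ (1 / p) := by
    intro N
    obtain ⟨n, hn, hlt⟩ := hcon N
    have := (hcε.trans_lt hlt).not_ge
    rw [weakLpNorm_le_iff hp _ hc0.le] at this
    push Not at this
    obtain ⟨φ, hφ, s, hs⟩ := this
    obtain ⟨a, ha, hab⟩ := aux_dual hpq s (fun j => φ (u (y (n + j))))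
    refine ⟨∑ j ∈ s, a j • y (n + j), ?_, n, hn, fun ψ => ?_⟩
    · have h1 : φ (u (∑ j ∈ s, a j • y (n + j))) = ∑ j ∈ s, a j * φ (u (y (n + j))) := by
        simp [map_sum]
      have h2 : ‖φ (u (∑ j ∈ s, a j • y (n + j)))‖ =
          (∑ j ∈ s, ‖φ (u (y (n + j)))‖ ^ p) ^ (1 / p) := by
        rw [h1, hab, RCLike.norm_ofReal, abs_of_nonneg]
        positivity
      calc c ≤ _ := hs.le
        _ = _ := h2.symm
        _ ≤ _ := φ.le_of_opNorm_le hφ _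
        _ = _ := one_mul _
    · have h1 : ψ (∑ j ∈ s, a j • y (n + j)) = ∑ j ∈ s, a j * ψ (y (n + j)) := by
        simp [map_sum]
      rw [h1]
      refine (aux_holder hpq s a _).trans ?_
      have h3 : (∑ j ∈ s, ‖a j‖ ^ q) ^ (1 / q) ≤ 1 :=
        Real.rpow_le_one (by positivity) ha (by have := hpq.symm.pos; positivity)
      refine (mul_le_of_le_one_left (by positivity) h3).trans ?_
      refine Real.rpow_le_rpow (by positivity) ?_ (by positivity)
      simp only [add_comm n]
      exact ((summable_nat_add_iff n).2 (hy ψ)).sum_le_tsum s (fun _ _ => by positivity)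
  choose x hx n hn hψ using key
  refine aux_compact u hu x (fun ψ => ?_) hc0 hx
  have ht : Tendsto n atTop atTop := tendsto_atTop_mono hn tendsto_id
  have h1 := (tendsto_sum_nat_add (fun j => ‖ψ (y j)‖ ^ p)).comp ht
  have h2 := h1.rpow_const (p := 1 / p) (Or.inr (by positivity))
  rw [Real.zero_rpow (by positivity)] at h2
  exact squeeze_zero_norm (fun N => hψ N ψ) h2

lemma aux_single {𝕜 : Type*} [RCLike 𝕜] {r : ℝ≥0∞} [Fact (1 ≤ r)] {p : ℝ}
    (hpq : p.HolderConjugate r.toReal) :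
    WeaklyLpSummable 𝕜 p (fun j => (lp.single r j (1 : 𝕜) : lp (fun _ : ℕ => 𝕜) r)) := by
  intro φ
  have hp := hpq.pos
  refine summable_of_sum_le (c := ‖φ‖ ^ p) (fun _ => by positivity) fun s => ?_
  rw [← aux_rpow hp (norm_nonneg _) (by positivity)]
  obtain ⟨a, ha, hab⟩ := aux_dual hpq s (fun j => φ (lp.single r j (1 : 𝕜)))
  have h1 : φ (∑ j ∈ s, lp.single r j (a j)) = ∑ j ∈ s, a j * φ (lp.single r j (1 : 𝕜)) := by
    rw [map_sum]
    refine Finset.sum_congr rfl fun j _ => ?_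
    rw [← smul_eq_mul, ← map_smul, ← lp.single_smul, smul_eq_mul, mul_one]
  have h2 : ‖φ (∑ j ∈ s, lp.single r j (a j))‖ =
      (∑ j ∈ s, ‖φ (lp.single r j (1 : 𝕜))‖ ^ p) ^ (1 / p) := by
    rw [h1, hab, RCLike.norm_ofReal, abs_of_nonneg]
    positivity
  rw [← h2]
  refine φ.le_of_opNorm_le_of_le le_rfl (b := 1) ?_ |>.trans (mul_one _).le
  have h3 := lp.norm_sum_single (E := fun _ : ℕ => 𝕜) hpq.symm.pos a s
  rw [← h3] at ha
  rw [← Real.one_rpow r.toReal] at ha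
  exact (Real.rpow_le_rpow_iff (norm_nonneg _) zero_le_one hpq.symm.pos).1 ha

/-- coordinate functional -/
noncomputable def lpCoord (𝕜 : Type*) [RCLike 𝕜] (r : ℝ≥0∞) [Fact (1 ≤ r)] (j : ℕ) :
    lp (fun _ : ℕ => 𝕜) r →L[𝕜] 𝕜 :=
  LinearMap.mkContinuous
    { toFun := fun x => x j
      map_add' := fun _ _ => rfl
      map_smul' := fun _ _ => rfl } 1 (fun x => by
        rw [one_mul]
        exact lp.norm_apply_le_norm (zero_lt_one.trans_le Fact.out).ne' x j)

lemma aux_backward {𝕜 : Type*} [RCLike 𝕜] {E : Type*} [NormedAddCommGroup E] [NormedSpace 𝕜 E]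
    [CompleteSpace E] {r : ℝ≥0∞} [Fact (1 ≤ r)] (hr : r ≠ ∞) {p : ℝ}
    (hpq : p.HolderConjugate r.toReal) (u : lp (fun _ : ℕ => 𝕜) r →L[𝕜] E)
    (h : UncondLpSummable 𝕜 p fun j => u (lp.single r j (1 : 𝕜))) : IsCompactOperator u := by
  have hp := hpq.pos
  let F : ℕ → lp (fun _ : ℕ => 𝕜) r →L[𝕜] E := fun n =>
    ∑ j ∈ Finset.range n, (lpCoord 𝕜 r j).smulRight (u (lp.single r j (1 : 𝕜)))
  have hF : ∀ n x, F n x = u (∑ j ∈ Finset.range n, lp.single r j (x j)) := by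
    intro n x
    simp only [F, _root_.sum_apply, map_sum, ContinuousLinearMap.smulRight_apply]
    refine Finset.sum_congr rfl fun j _ => ?_
    rw [← map_smul, ← lp.single_smul, smul_eq_mul, mul_one]
    rfl
  have hcomp : ∀ n, IsCompactOperator (F n) := by
    intro n
    induction n with
    | zero => simpa [F] using! isCompactOperator_zero
    | succ n ih =>
      have h1 : IsCompactOperator ((lpCoord 𝕜 r n).smulRight (u (lp.single r n (1 : 𝕜)))) := by
        have h2 : IsCompactOperator (lpCoord 𝕜 r n) :=
          isCompactOperator_of_locallyCompactSpace_dom (lpCoord 𝕜 r n)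
        exact h2.clm_comp (ContinuousLinearMap.toSpanSingleton 𝕜 (u (lp.single r n (1 : 𝕜))))
      have h3 : F (n + 1) = F n + (lpCoord 𝕜 r n).smulRight (u (lp.single r n (1 : 𝕜))) :=
        Finset.sum_range_succ _ _
      rw [h3]
      exact ih.add h1
  refine isCompactOperator_of_tendsto (l := atTop) (F := F) ?_ (Eventually.of_forall hcomp)
  rw [Metric.tendsto_atTop]
  intro ε hε
  obtain ⟨N, hN⟩ := (ENNReal.tendsto_atTop_zero.1 h.2) (ENNReal.ofReal (ε / 2)) (by simpa)
  refine ⟨N, fun n hn => ?_⟩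
  have hw := (weakLpNorm_le_iff hp _ (by positivity)).1 (hN n hn)
  rw [dist_comm, dist_eq_norm]
  refine lt_of_le_of_lt (ContinuousLinearMap.opNorm_le_bound _ (half_pos hε).le fun x => ?_)
    (half_lt_self hε)
  have hs := lp.hasSum_single hr x
  have ht : Tendsto (fun m => u (∑ j ∈ Finset.range (m + n), lp.single r j (x j)) - F n x) atTop
      (𝓝 ((u - F n) x)) :=
    (((u.continuous.tendsto _).comp hs.tendsto_sum_nat).comp (tendsto_add_atTop_nat n)).sub_const _
  refine le_of_tendsto' ht.norm fun m => ?_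
  rw [hF, ← map_sub, add_comm m n, Finset.sum_range_add, add_sub_cancel_left]
  obtain ⟨g, hg, hgx⟩ :=
    exists_dual_vector'' 𝕜 (u (∑ j ∈ Finset.range m, lp.single r (n + j) (x (n + j))))
  have h1 : g (u (∑ j ∈ Finset.range m, lp.single r (n + j) (x (n + j)))) =
      ∑ j ∈ Finset.range m, x (n + j) * g (u (lp.single r (n + j) (1 : 𝕜))) := by
    rw [map_sum, map_sum]
    refine Finset.sum_congr rfl fun j _ => ?_
    rw [← smul_eq_mul, ← map_smul, ← map_smul, ← lp.single_smul, smul_eq_mul, mul_one]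
  have h2 := congrArg norm hgx
  rw [RCLike.norm_ofReal, abs_norm, h1] at h2
  rw [← h2]
  refine (aux_holder hpq _ _ _).trans ?_
  rw [mul_comm]
  refine mul_le_mul (hw g hg _) ?_ (by positivity) (by positivity)
  rw [aux_rpow hpq.symm.pos (norm_nonneg _) (by positivity)]
  have h4 := lp.sum_rpow_le_norm_rpow hpq.symm.pos x
    ((Finset.range m).map (addLeftEmbedding n))
  simpa using h4

/-- For `1 < p < ∞` and `p* = p/(p-1)`, a bounded operator
`u : ℓ_{p*} → E` is compact iff `(u(y_j))_j` is unconditionally `p`-summable for every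
weakly `p`-summable sequence `(y_j)` in `ℓ_{p*}`. -/
theorem stmt_17 {𝕜 : Type*} [RCLike 𝕜] {E : Type*} [NormedAddCommGroup E] [NormedSpace 𝕜 E]
    [CompleteSpace E] {p : ℝ} (hp : 1 < p) [Fact (1 ≤ ENNReal.ofReal (p / (p - 1)))]
    (u : lp (fun _ : ℕ => 𝕜) (ENNReal.ofReal (p / (p - 1))) →L[𝕜] E) :
    IsCompactOperator ⇑u ↔
      ∀ y : ℕ → lp (fun _ : ℕ => 𝕜) (ENNReal.ofReal (p / (p - 1))),
        WeaklyLpSummable 𝕜 p y → UncondLpSummable 𝕜 p fun j => u (y j) := by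
  have hpq : p.HolderConjugate (p / (p - 1)) := Real.HolderConjugate.conjExponent hp
  have hr : (ENNReal.ofReal (p / (p - 1))).toReal = p / (p - 1) :=
    ENNReal.toReal_ofReal hpq.symm.nonneg
  refine ⟨fun hu y hy => aux_forward hpq u hu y hy, fun h => ?_⟩
  have hpq' : p.HolderConjugate (ENNReal.ofReal (p / (p - 1))).toReal := by rwa [hr]
  exact aux_backward ENNReal.ofReal_ne_top hpq' u (h _ (aux_single hpq'))
end
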